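/- For every term M of the simply typed call-by-value λ-calculus λ, the readback of its administrative translation satisfies R(⌈M⌉) ≡ M (α-equivalence). -/

import Mathlib

/-!
Formalization of the calculi of "A decompilation of the π-calculus and its
application to termination" (R. Amadio), functional case.

Variables are named (natural numbers); terms are manipulated up to
α-renaming via an explicitly defined α-equivalence relation, and
substitution is the textbook (naive) one, in accordance with the paper's
convention that bound variables are suitably renamed.
-/

namespace DecompPi

abbrev Var := ℕ

/-! ## The simply typed call-by-value λ-calculus λ -/

inductive Ty : Type
  | unit : Ty
  | arr : Ty → Ty → Ty

inductive Tm : Type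
  | star : Tm
  | var : Var → Tm
  | lam : Var → Tm → Tm
  | app : Tm → Tm → Tm

namespace Tm

/-- Values of λ : `*`, variables and abstractions. -/
inductive IsValue : Tm → Prop
  | star : IsValue .star
  | var (x : Var) : IsValue (.var x)
  | lam (x : Var) (M : Tm) : IsValue (.lam x M)

/-- Free variables. -/
def fv : Tm → Finset Var
  | .star => ∅
  | .var x => {x}
  | .lam x M => fv M \ {x}
  | .app M N => fv M ∪ fv N

/-- Substitution `[V/x]M` (bound variables are assumed suitably renamed). -/
def subst (V : Tm) (x : Var) : Tm → Tm
  | .star => .star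
  | .var y => if y = x then V else .var y
  | .lam y M => if y = x then .lam y M else .lam y (subst V x M)
  | .app M N => .app (subst V x M) (subst V x N)

/-- α-equivalence of λ-terms. -/
inductive Aeq : Tm → Tm → Prop
  | star : Aeq .star .star
  | var (x : Var) : Aeq (.var x) (.var x)
  | app {M M' N N'} : Aeq M M' → Aeq N N' → Aeq (.app M N) (.app M' N')
  | lam {M N} (x y : Var) :
      (∀ z, z ∉ fv M → z ∉ fv N →
        Aeq (subst (.var z) x M) (subst (.var z) y N)) →
      Aeq (.lam x M) (.lam y N)

end Tm

/-- Evaluation contexts of λ : `E ::= [ ] | E[[ ] M] | E[V [ ]]`. -/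
inductive ECtx : Type
  | hole : ECtx
  | appFun : ECtx → Tm → ECtx    -- E[[ ] M]
  | appArg : ECtx → Tm → ECtx    -- E[V [ ]]

/-- Well-formedness: in `E[V [ ]]` the term `V` must be a value. -/
def ECtx.Ok : ECtx → Prop
  | .hole => True
  | .appFun E _ => E.Ok
  | .appArg E V => Tm.IsValue V ∧ E.Ok

def ECtx.plug : ECtx → Tm → Tm
  | .hole, t => t
  | .appFun E M, t => E.plug (.app t M)
  | .appArg E V, t => E.plug (.app V t)

/-- Call-by-value reduction of λ, `E[(λx.M)V] → E[[V/x]M]`,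
closed under α-equivalence. -/
inductive Red : Tm → Tm → Prop
  | beta (E : ECtx) (x : Var) (M V : Tm) :
      E.Ok → Tm.IsValue V →
      Red (E.plug (.app (.lam x M) V)) (E.plug (Tm.subst V x M))
  | equiv {M M' N N' : Tm} : Tm.Aeq M M' → Red M' N' → Tm.Aeq N' N → Red M N

/-- Lookup in a typing context (most recent binding first). -/
def lk {α : Type} : List (Var × α) → Var → Option α
  | [], _ => none
  | (y, A) :: Γ, x => if x = y then some A else lk Γ x

/-- Typing of λ. -/
inductive TyJ : List (Var × Ty) → Tm → Ty → Prop
  | var {Γ x A} : lk Γ x = some A → TyJ Γ (.var x) A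
  | star {Γ} : TyJ Γ .star .unit
  | lam {Γ x A M B} : TyJ ((x, A) :: Γ) M B → TyJ Γ (.lam x M) (.arr A B)
  | app {Γ M N A B} : TyJ Γ M (.arr A B) → TyJ Γ N A → TyJ Γ (.app M N) B

/-! ## λᵃ : the λ-calculus in administrative form -/

/-! Types of λᵃ : `A ::= Ch(1) | Ch(A⁺ → A)`; `AFn` represents a
nonempty sequence of argument types followed by a result type. -/
mutual
  inductive ATy : Type
    | chUnit : ATy
    | ch : AFn → ATy
  inductive AFn : Type
    | last : ATy → ATy → AFn        -- A → B  (final argument, result)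
    | more : ATy → AFn → AFn        -- A → (…)
end

/-! Syntax of λᵃ.  `AVal.lam y ys D` is `λ y ys⃗ . D` (a nonempty binder list);
`ADec` are declarations `(let x = V in)* M`; `ATm.app M sp` is `@(M, N⁺)`
with `sp` a nonempty spine of arguments. -/
mutual
  inductive AVal : Type
    | star : AVal
    | lam : Var → List Var → ADec → AVal
  inductive ADec : Type
    | lett : Var → AVal → ADec → ADec
    | tm : ATm → ADec
  inductive ATm : Type
    | var : Var → ATm
    | app : ATm → ASp → ATm
  inductive ASp : Type
    | single : ATm → ASp
    | cons : ATm → ASp → ASp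
end

/-! Free variables and all (free or bound) variables. -/

mutual
  def fvV : AVal → Finset Var
    | .star => ∅
    | .lam y ys D => fvD D \ insert y ys.toFinset
  def fvD : ADec → Finset Var
    | .lett x V D => fvV V ∪ (fvD D \ {x})
    | .tm M => fvT M
  def fvT : ATm → Finset Var
    | .var x => {x}
    | .app M sp => fvT M ∪ fvS sp
  def fvS : ASp → Finset Var
    | .single M => fvT M
    | .cons M sp => fvT M ∪ fvS sp
end

mutual
  def varsV : AVal → Finset Var
    | .star => ∅
    | .lam y ys D => varsD D ∪ insert y ys.toFinset
  def varsD : ADec → Finset Var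
    | .lett x V D => insert x (varsV V ∪ varsD D)
    | .tm M => varsT M
  def varsT : ATm → Finset Var
    | .var x => {x}
    | .app M sp => varsT M ∪ varsS sp
  def varsS : ASp → Finset Var
    | .single M => varsT M
    | .cons M sp => varsT M ∪ varsS sp
end

/-! Simultaneous renaming (substitution of variables for variables),
used for `[z⁺/y⁺]D` and for α-renaming. -/

def rlook (σ : List (Var × Var)) (x : Var) : Var :=
  ((σ.find? (fun p => p.1 == x)).map Prod.snd).getD x

def rdel (σ : List (Var × Var)) (xs : List Var) : List (Var × Var) :=
  σ.filter (fun p => !xs.contains p.1)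

mutual
  def rnV (σ : List (Var × Var)) : AVal → AVal
    | .star => .star
    | .lam y ys D => .lam y ys (rnD (rdel σ (y :: ys)) D)
  def rnD (σ : List (Var × Var)) : ADec → ADec
    | .lett x V D => .lett x (rnV σ V) (rnD (rdel σ [x]) D)
    | .tm M => .tm (rnT σ M)
  def rnT (σ : List (Var × Var)) : ATm → ATm
    | .var x => .var (rlook σ x)
    | .app M sp => .app (rnT σ M) (rnS σ sp)
  def rnS (σ : List (Var × Var)) : ASp → ASp
    | .single M => .single (rnT σ M)
    | .cons M sp => .cons (rnT σ M) (rnS σ sp)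
end

/-! Structural congruence of λᵃ : the least equivalence relation induced by
the two displayed equations and α-renaming, closed under the operators of
the language. -/

mutual
  inductive SCv : AVal → AVal → Prop
    | refl (V) : SCv V V
    | symm {V V'} : SCv V V' → SCv V' V
    | trans {V₁ V₂ V₃} : SCv V₁ V₂ → SCv V₂ V₃ → SCv V₁ V₃
    | lam {D D'} (y : Var) (ys : List Var) : SCd D D' → SCv (.lam y ys D) (.lam y ys D')
    | alpha {D} (y z : Var) (ys zs : List Var) :
        (y :: ys).length = (z :: zs).length → (z :: zs).Nodup →
        (∀ w ∈ z :: zs, w ∉ varsD D) →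
        SCv (.lam y ys D) (.lam z zs (rnD ((y :: ys).zip (z :: zs)) D))
  inductive SCd : ADec → ADec → Prop
    | refl (D) : SCd D D
    | symm {D D'} : SCd D D' → SCd D' D
    | trans {D₁ D₂ D₃} : SCd D₁ D₂ → SCd D₂ D₃ → SCd D₁ D₃
    | swap {V₁ V₂ D} (x₁ x₂ : Var) :
        x₁ ≠ x₂ → x₁ ∉ fvV V₂ → x₂ ∉ fvV V₁ →
        SCd (.lett x₁ V₁ (.lett x₂ V₂ D)) (.lett x₂ V₂ (.lett x₁ V₁ D))
    | gc {V D} (x : Var) : x ∉ fvD D → SCd (.lett x V D) D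
    | lett {V V' D D'} (x : Var) : SCv V V' → SCd D D' → SCd (.lett x V D) (.lett x V' D')
    | tm {M M'} : SCt M M' → SCd (.tm M) (.tm M')
    | alpha {V D} (x z : Var) :
        z ∉ varsD D → SCd (.lett x V D) (.lett z V (rnD [(x, z)] D))
  inductive SCt : ATm → ATm → Prop
    | refl (M) : SCt M M
    | symm {M M'} : SCt M M' → SCt M' M
    | trans {M₁ M₂ M₃} : SCt M₁ M₂ → SCt M₂ M₃ → SCt M₁ M₃
    | app {M M' sp sp'} : SCt M M' → SCs sp sp' → SCt (.app M sp) (.app M' sp')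
  inductive SCs : ASp → ASp → Prop
    | refl (sp) : SCs sp sp
    | symm {sp sp'} : SCs sp sp' → SCs sp' sp
    | trans {s₁ s₂ s₃} : SCs s₁ s₂ → SCs s₂ s₃ → SCs s₁ s₃
    | single {M M'} : SCt M M' → SCs (.single M) (.single M')
    | cons {M M' sp sp'} : SCt M M' → SCs sp sp' → SCs (.cons M sp) (.cons M' sp')
end

/-! Typing of λᵃ, parametrized by a predicate `P` on types; `P := ⊤` gives
λᵃ itself, `P := MonTy` its monadic fragment λᵃᵐ, and `P := CpsTy R`
the CPS fragment λᵃᵏ. -/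

/-- `PBind ys f Γ Γ' C`: binding the parameters `ys` at the argument types
of the (nonempty) arrow `f` extends `Γ` to `Γ'`, with result type `C`. -/
inductive PBind : List Var → AFn → List (Var × ATy) → List (Var × ATy) → ATy → Prop
  | last {y A C Γ} : PBind [y] (.last A C) Γ ((y, A) :: Γ) C
  | more {y ys A f Γ Γ' C} :
      PBind ys f ((y, A) :: Γ) Γ' C → PBind (y :: ys) (.more A f) Γ Γ' C

mutual
  inductive TyD (P : ATy → Prop) : List (Var × ATy) → ADec → ATy → Prop
    | star {Γ x D A} : P .chUnit → TyD P ((x, .chUnit) :: Γ) D A →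
        TyD P Γ (.lett x .star D) A
    | lam {Γ Γ' x y ys f D' D C B} :
        P (.ch f) → PBind (y :: ys) f Γ Γ' C → TyD P Γ' D' C →
        TyD P ((x, .ch f) :: Γ) D B →
        TyD P Γ (.lett x (.lam y ys D') D) B
    | tm {Γ M A} : TyM P Γ M A → TyD P Γ (.tm M) A
  inductive TyM (P : ATy → Prop) : List (Var × ATy) → ATm → ATy → Prop
    | var {Γ x A} : lk Γ x = some A → TyM P Γ (.var x) A
    | app {Γ M sp f B} : TyM P Γ M (.ch f) → TySp P Γ sp f B → TyM P Γ (.app M sp) B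
  inductive TySp (P : ATy → Prop) : List (Var × ATy) → ASp → AFn → ATy → Prop
    | single {Γ N A B} : TyM P Γ N A → TySp P Γ (.single N) (.last A B) B
    | cons {Γ N rest A f B} : TyM P Γ N A → TySp P Γ rest f B →
        TySp P Γ (.cons N rest) (.more A f) B
end

/-- Monadic types: `A ::= Ch(1) | Ch(A → A)`. -/
inductive MonTy : ATy → Prop
  | unit : MonTy .chUnit
  | ch {A B} : MonTy A → MonTy B → MonTy (.ch (.last A B))

/-! ## Readback translation R from λᵃ to λ -/

def mkLams (y : Var) (ys : List Var) (t : Tm) : Tm :=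
  .lam y (ys.foldr .lam t)

mutual
  def rbV : AVal → Tm
    | .star => .star
    | .lam y ys D => mkLams y ys (rbD D)
  def rbD : ADec → Tm
    | .lett x V D => Tm.subst (rbV V) x (rbD D)
    | .tm M => rbT M
  def rbT : ATm → Tm
    | .var x => .var x
    | .app M sp => rbS (rbT M) sp
  def rbS : Tm → ASp → Tm
    | f, .single N => .app f (rbT N)
    | f, .cons N sp => rbS (.app f (rbT N)) sp
end

mutual
  def rbTy : ATy → Ty
    | .chUnit => .unit
    | .ch f => rbFn f
  def rbFn : AFn → Ty
    | .last A B => .arr (rbTy A) (rbTy B)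
    | .more A f => .arr (rbTy A) (rbFn f)
end

def rbCtx (Γ : List (Var × ATy)) : List (Var × Ty) :=
  Γ.map (fun p => (p.1, rbTy p.2))

/-! ## The administrative translation ⌈·⌉ from λ to λᵃ -/

/-- The let-prefix of a declaration. -/
def letsOf : ADec → List (Var × AVal)
  | .lett x V D => (x, V) :: letsOf D
  | .tm _ => []

/-- The body term of a declaration. -/
def termOf : ADec → ATm
  | .lett _ _ D => termOf D
  | .tm M => M

def wrapLets (l : List (Var × AVal)) (D : ADec) : ADec :=
  l.foldr (fun p D => .lett p.1 p.2 D) D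

def letNames (D : ADec) : Finset Var := ((letsOf D).map Prod.fst).toFinset

/-- The administrative translation, presented as a relation (the fresh
names and the renamings implicit in the `@(D,D')` abbreviation are
constrained by side conditions).  `Adm M D` reads: `D` is (an
administrative form) `⌈M⌉`. -/
inductive Adm : Tm → ADec → Prop
  | var (x : Var) : Adm (.var x) (.tm (.var x))
  | star (x : Var) : Adm .star (.lett x .star (.tm (.var x)))
  | lam {M D} (x x' : Var) :
      Adm M D → x' ∉ insert x (varsD D) →
      Adm (.lam x M) (.lett x' (.lam x [] D) (.tm (.var x')))
  | app {M N DM DN} :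
      Adm M DM → Adm N DN →
      Disjoint (letNames DM) (varsD DN) → Disjoint (letNames DN) (varsD DM) →
      Adm (.app M N)
        (wrapLets (letsOf DM ++ letsOf DN)
          (.tm (.app (termOf DM) (.single (termOf DN)))))

/-- Administrative translation on types : `⌈1⌉ = Ch(1)`, `⌈A→B⌉ = Ch(⌈A⌉→⌈B⌉)`. -/
def admTy : Ty → ATy
  | .unit => .chUnit
  | .arr A B => .ch (.last (admTy A) (admTy B))

def admCtx (Γ : List (Var × Ty)) : List (Var × ATy) :=
  Γ.map (fun p => (p.1, admTy p.2))

/-! ## Reduction of λᵃ -/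

/-- Evaluation contexts of λᵃ : `E ::= let x = V in [ ] | E[@(x*, [ ], M*)]`. -/
inductive AEctx : Type
  | letHole : Var → AVal → AEctx
  | appHole : AEctx → List Var → List ATm → AEctx

def AEctx.Ok : AEctx → Prop
  | .letHole _ _ => True
  | .appHole E xs ms => (xs ≠ [] ∨ ms ≠ []) ∧ E.Ok

/-- Bound (let- ) names of an evaluation context. -/
def AEctx.bnames : AEctx → Finset Var
  | .letHole x _ => {x}
  | .appHole E _ _ => E.bnames

def mkSp : ATm → List ATm → ASp
  | t, [] => .single t
  | t, m :: r => .cons t (mkSp m r)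

def mkArgs : List Var → ATm → List ATm → ASp
  | [], t, ms => mkSp t ms
  | y :: r, t, ms => .cons (.var y) (mkArgs r t ms)

/-- `mkApp xs t ms` is the term `@(x*, t, M*)`. -/
def mkApp (xs : List Var) (t : ATm) (ms : List ATm) : ATm :=
  match xs, ms with
  | [], [] => t
  | [], m :: r => .app t (mkSp m r)
  | x :: xs', _ => .app (.var x) (mkArgs xs' t ms)

/-- Plugging a term in the hole of an evaluation context. -/
def AEctx.plugTm : AEctx → ATm → ADec
  | .letHole x V, t => .lett x V (.tm t)
  | .appHole E xs ms, t => E.plugTm (mkApp xs t ms)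

/-- Plugging a declaration in the hole of an evaluation context: as in the
paper, the let-declarations float to the outside. -/
def AEctx.plugD (E : AEctx) (D : ADec) : ADec :=
  wrapLets (letsOf D) (E.plugTm (termOf D))

/-- The spine of variables `z⁺`. -/
def varSp (z : Var) (zs : List Var) : ASp :=
  mkSp (.var z) (zs.map .var)

/-- Reduction of λᵃ :
`E[let x = λy⁺.D in E'[@(x,z⁺)]] → E[let x = λy⁺.D in E'[[z⁺/y⁺]D]]`,
closed under structural congruence. -/
inductive ARed : ADec → ADec → Prop
  | beta (E E' : AEctx) (x y : Var) (ys : List Var) (B : ADec) (z : Var) (zs : List Var) :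
      E.Ok → E'.Ok → x ∉ E'.bnames →
      (z :: zs).length = (y :: ys).length →
      ARed (E.plugD (.lett x (.lam y ys B) (E'.plugTm (.app (.var x) (varSp z zs)))))
           (E.plugD (.lett x (.lam y ys B) (E'.plugD (rnD ((y :: ys).zip (z :: zs)) B))))
  | equiv {D₁ D₁' D₂ D₂'} : SCd D₁ D₁' → ARed D₁' D₂' → SCd D₂' D₂ → ARed D₁ D₂

/-! ## λᵃᵏ : administrative forms in CPS style -/

/-! CPS types (relative to the fixed result type `R`) :
`A ::= Ch(1) | Ch(A⁺ → R)`. -/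
mutual
  inductive CpsTy (R : ATy) : ATy → Prop
    | unit : CpsTy R .chUnit
    | ch {f} : CpsFn R f → CpsTy R (.ch f)
  inductive CpsFn (R : ATy) : AFn → Prop
    | last {A} : CpsTy R A → CpsFn R (.last A R)
    | more {A f} : CpsTy R A → CpsFn R f → CpsFn R (.more A f)
end

/-- Spines made of variables only. -/
inductive SpVars : ASp → Prop
  | single (z : Var) : SpVars (.single (.var z))
  | cons (z : Var) {sp} : SpVars sp → SpVars (.cons (.var z) sp)

/-! Syntactic CPS fragment λᵃᵏ : terms are `@(x, y⁺)` only. -/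
mutual
  inductive FragV : AVal → Prop
    | star : FragV .star
    | lam {y ys D} : FragD D → FragV (.lam y ys D)
  inductive FragD : ADec → Prop
    | lett {x V D} : FragV V → FragD D → FragD (.lett x V D)
    | tm {x sp} : SpVars sp → FragD (.tm (.app (.var x) sp))
end

/-! The CPS type translation `K*` (with result type `R`). -/
mutual
  def kstar (R : ATy) : ATy → ATy
    | .chUnit => .chUnit
    | .ch f => .ch (kfn R f)
  def kfn (R : ATy) : AFn → AFn
    | .last A B => .more (kstar R A) (.last (.ch (.last (kstar R B) R)) R)
    | .more A f => .more (kstar R A) (kfn R f)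
end

/-- `K(A) = Ch(K*(A) → R)`. -/
def kTy (R A : ATy) : ATy := .ch (.last (kstar R A) R)

def kCtx (R : ATy) (Γ : List (Var × ATy)) : List (Var × ATy) :=
  Γ.map (fun p => (p.1, kstar R p.2))

def spSnoc : ASp → ATm → ASp
  | .single M, t => .cons M (.single t)
  | .cons M sp, t => .cons M (spSnoc sp t)

/-! The optimized CPS translation, as a relation: `CpsV V V'` is `ψ(V) = V'`,
`CpsD D k Dk` is `(D : k) = Dk` and `CpsM M k Dk` is `(M : k) = Dk`
(fresh names are constrained by side conditions). -/
mutual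
  inductive CpsV : AVal → AVal → Prop
    | star : CpsV .star .star
    | lam {y ys D Dk} (k : Var) :
        k ∉ insert y ys.toFinset → k ∉ varsD D →
        CpsD D k Dk →
        CpsV (.lam y ys D) (.lam y (ys ++ [k]) Dk)
  inductive CpsD : ADec → Var → ADec → Prop
    | lett {x V V' D Dk k} :
        k ∉ varsD (.lett x V D) →
        CpsV V V' → CpsD D k Dk →
        CpsD (.lett x V D) k (.lett x V' Dk)
    | tm {M k Dk} : CpsM M k Dk → CpsD (.tm M) k Dk
  inductive CpsM : ATm → Var → ADec → Prop
    | var (x k : Var) : CpsM (.var x) k (.tm (.app (.var k) (.single (.var x))))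
    | appVars (x z : Var) (zs : List Var) (k : Var) :
        CpsM (.app (.var x) (varSp z zs)) k
             (.tm (.app (.var x) (spSnoc (varSp z zs) (.var k))))
    | appStep {xs : List Var} {M : ATm} {margs : ASp} {ns : List ATm}
        {k k' y : Var} {Dbody Dinner : ADec} :
        (xs ≠ [] ∨ ns ≠ []) →
        y ∉ varsT (mkApp xs (.app M margs) ns) → y ≠ k →
        k' ∉ varsT (mkApp xs (.app M margs) ns) → k' ≠ k → k' ≠ y →
        CpsM (mkApp xs (.var y) ns) k Dbody →
        CpsM (.app M margs) k' Dinner →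
        CpsM (mkApp xs (.app M margs) ns) k (.lett k' (.lam y [] Dbody) Dinner)
end

namespace Tm

theorem subst_eq_self {V : Tm} {x : Var} : ∀ {M : Tm}, x ∉ fv M → subst V x M = M
  | .star, _ => rfl
  | .var y, h => by
    have hy : y ≠ x := by rintro rfl; simp [fv] at h
    simp [subst, hy]
  | .lam y M, h => by
    by_cases hy : y = x
    · simp [subst, hy]
    · have hM : x ∉ fv M := fun hx => h (by simp [fv, hx, Ne.symm hy])
      simp [subst, hy, subst_eq_self hM]
  | .app M N, h => by
    simp only [fv, Finset.mem_union, not_or] at h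
    simp [subst, subst_eq_self h.1, subst_eq_self h.2]

theorem fv_subst_subset (V : Tm) (x : Var) : ∀ M : Tm, fv (subst V x M) ⊆ fv V ∪ fv M
  | .star => by simp [subst, fv]
  | .var y => by
    by_cases hy : y = x <;> simp [subst, fv, hy]
  | .lam y M => by
    have ih := fv_subst_subset V x M
    by_cases hy : y = x
    · simp [subst, hy]
    · intro z hz
      simp only [subst, hy, if_false, fv, Finset.mem_sdiff] at hz
      have := ih hz.1
      simp only [fv, Finset.mem_union, Finset.mem_sdiff] at this ⊢
      tauto
  | .app M N => by
    have ihM := fv_subst_subset V x M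
    have ihN := fv_subst_subset V x N
    intro z hz
    simp only [subst, fv, Finset.mem_union] at hz ⊢
    rcases hz with hz | hz
    · have := ihM hz
      simp only [Finset.mem_union] at this
      tauto
    · have := ihN hz
      simp only [Finset.mem_union] at this
      tauto

/-- The number of constructors of a term. -/
def size : Tm → ℕ
  | .star => 1
  | .var _ => 1
  | .lam _ M => size M + 1
  | .app M N => size M + size N + 1

theorem size_subst_var (z x : Var) : ∀ M : Tm, size (subst (.var z) x M) = size M
  | .star => rfl
  | .var y => by by_cases hy : y = x <;> simp [subst, size, hy]
  | .lam y M => by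
    by_cases hy : y = x <;> simp [subst, size, hy, size_subst_var z x M]
  | .app M N => by simp [subst, size, size_subst_var z x M, size_subst_var z x N]

theorem Aeq.refl : ∀ M : Tm, Aeq M M
  | .star => .star
  | .var x => .var x
  | .lam x M => .lam x x fun z _ _ => Aeq.refl (subst (.var z) x M)
  | .app M N => .app (Aeq.refl M) (Aeq.refl N)
termination_by M => size M
decreasing_by all_goals simp only [size_subst_var, size]; omega

end Tm

theorem fv_foldr_lam_subset (ys : List Var) (t : Tm) : (ys.foldr Tm.lam t).fv ⊆ t.fv := by
  induction ys with
  | nil => simp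
  | cons y ys ih => exact Finset.sdiff_subset.trans ih

mutual
  theorem fv_rbV_subset : ∀ V : AVal, (rbV V).fv ⊆ varsV V
    | .star => by simp [rbV, Tm.fv]
    | .lam y ys D => by
      simp only [rbV, mkLams, Tm.fv, varsV]
      exact Finset.sdiff_subset.trans ((fv_foldr_lam_subset ys _).trans
        ((fv_rbD_subset D).trans Finset.subset_union_left))
  theorem fv_rbD_subset : ∀ D : ADec, (rbD D).fv ⊆ varsD D
    | .lett x V D => by
      simp only [rbD, varsD]
      exact (Tm.fv_subst_subset _ _ _).trans
        ((Finset.union_subset_union (fv_rbV_subset V) (fv_rbD_subset D)).trans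
          (Finset.subset_insert _ _))
    | .tm M => by
      simp only [rbD, varsD]
      exact fv_rbT_subset M
  theorem fv_rbT_subset : ∀ M : ATm, (rbT M).fv ⊆ varsT M
    | .var x => by simp [rbT, varsT, Tm.fv]
    | .app M sp => by
      simp only [rbT, varsT]
      exact (fv_rbS_subset _ sp).trans
        (Finset.union_subset_union (fv_rbT_subset M) (Finset.Subset.refl _))
  theorem fv_rbS_subset : ∀ (f : Tm) (sp : ASp), (rbS f sp).fv ⊆ f.fv ∪ varsS sp
    | f, .single N => by
      simp only [rbS, varsS, Tm.fv]
      exact Finset.union_subset_union (Finset.Subset.refl _) (fv_rbT_subset N)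
    | f, .cons N sp => by
      simp only [rbS, varsS]
      refine (fv_rbS_subset _ sp).trans ?_
      rw [← Finset.union_assoc]
      exact Finset.union_subset_union
        (Finset.union_subset_union (Finset.Subset.refl _) (fv_rbT_subset N))
        (Finset.Subset.refl _)
end

theorem varsT_termOf_subset : ∀ D : ADec, varsT (termOf D) ⊆ varsD D
  | .lett x V D => by
    simp only [termOf, varsD]
    exact (varsT_termOf_subset D).trans
      (Finset.subset_union_right.trans (Finset.subset_insert _ _))
  | .tm M => by simp [termOf, varsD]

/-- The substitutions performed by the readback of a let-prefix. -/
def substLets (l : List (Var × AVal)) (t : Tm) : Tm :=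
  l.foldr (fun p t => Tm.subst (rbV p.2) p.1 t) t

theorem rbD_wrapLets (l : List (Var × AVal)) (D : ADec) :
    rbD (wrapLets l D) = substLets l (rbD D) := by
  induction l with
  | nil => rfl
  | cons p l ih =>
    change rbD (.lett p.1 p.2 (wrapLets l D)) = Tm.subst (rbV p.2) p.1 (substLets l (rbD D))
    rw [rbD, ih]

theorem substLets_letsOf : ∀ D : ADec, substLets (letsOf D) (rbT (termOf D)) = rbD D
  | .lett x V D => by
    rw [rbD, ← substLets_letsOf D]
    rfl
  | .tm M => by
    rw [rbD]
    rfl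

theorem substLets_append (l₁ l₂ : List (Var × AVal)) (t : Tm) :
    substLets (l₁ ++ l₂) t = substLets l₁ (substLets l₂ t) :=
  List.foldr_append

theorem substLets_app (l : List (Var × AVal)) (M N : Tm) :
    substLets l (.app M N) = .app (substLets l M) (substLets l N) := by
  induction l with
  | nil => rfl
  | cons p l ih =>
    change Tm.subst (rbV p.2) p.1 (substLets l (.app M N)) = _
    rw [ih]
    rfl

theorem substLets_eq_self {l : List (Var × AVal)} {t : Tm}
    (h : Disjoint (l.map Prod.fst).toFinset t.fv) : substLets l t = t := by
  induction l with
  | nil => rfl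
  | cons p l ih =>
    simp only [List.map_cons, List.toFinset_cons, Finset.disjoint_insert_left] at h
    change Tm.subst (rbV p.2) p.1 (substLets l t) = t
    rw [ih h.2, Tm.subst_eq_self h.1]

/-- Readback inverts the administrative translation on the nose. -/
theorem Adm.rbD_eq {M : Tm} {D : ADec} (h : Adm M D) : rbD D = M := by
  induction h with
  | var x => simp [rbD, rbT]
  | star x => simp [rbD, rbT, rbV, Tm.subst]
  | lam x x' _ _ ih => simp [rbD, rbT, rbV, mkLams, Tm.subst, ih]
  | @app M N DM DN _ _ hMN hNM ihM ihN =>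
    have hfun : substLets (letsOf DN) (rbT (termOf DM)) = rbT (termOf DM) :=
      substLets_eq_self (hNM.mono_right ((fv_rbT_subset _).trans (varsT_termOf_subset DM)))
    have harg : substLets (letsOf DM) (rbD DN) = rbD DN :=
      substLets_eq_self (hMN.mono_right (fv_rbD_subset DN))
    rw [rbD_wrapLets, substLets_append, rbD, rbT, rbS, substLets_app, substLets_app, hfun,
      substLets_letsOf, substLets_letsOf, harg, ihM, ihN]

/-- Theorem 1(2): for every λ-term `M`,
`R(⌈M⌉) ≡ M` (α-equivalence). -/
theorem readback_of_adm (M : Tm) (D : ADec) (h : Adm M D) :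
    Tm.Aeq (rbD D) M := by
  rw [h.rbD_eq]
  exact Tm.Aeq.refl M

end DecompPi
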